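/- arXiv:2302.04953 — 3 statements merged into one kernel-verified Lean document; each statement's English description precedes it below -/
import Mathlib

section
/- Let Ω ⊂ ℝ^d be a compact set, c : Ω × Ω → ℝ a continuous cost function, and ρ, μ, ν Borel probability measures on Ω with Spt(μ) ⊆ Spt(ρ). Let T : Ω → Ω be a continuous map with T♯μ = ν and M^c_ρ(T) = 0. Then T is a c-optimal transport map between μ and ν, i.e., ∫_Ω c(x, T(x)) dμ(x) = W_c(μ, ν). -/
open MeasureTheory

/-- The Kantorovich optimal transport cost: infimum of `∫∫ c dπ` over couplings `π`
of `μ` and `ν`. -/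
noncomputable def kantorovichCost {α β : Type*} [MeasurableSpace α] [MeasurableSpace β]
    (c : α → β → ℝ) (μ : Measure α) (ν : Measure β) : ℝ :=
  sInf {r : ℝ | ∃ π : Measure (α × β), IsProbabilityMeasure π ∧
    π.map Prod.fst = μ ∧ π.map Prod.snd = ν ∧ r = ∫ p, c p.1 p.2 ∂π}

/-- The Monge gap of a map `T` with reference measure `ρ` and cost `c`. -/
noncomputable def mongeGap {α : Type*} [MeasurableSpace α]
    (c : α → α → ℝ) (ρ : Measure α) (T : α → α) : ℝ :=
  (∫ x, c x (T x) ∂ρ) - kantorovichCost c ρ (ρ.map T)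

/-- The topological support of a Borel measure. -/
def measureSupport {α : Type*} [TopologicalSpace α] [MeasurableSpace α]
    (μ : Measure α) : Set α :=
  {x | ∀ U : Set α, x ∈ U → IsOpen U → 0 < μ U}

open ProbabilityTheory Filter Topology
open scoped ENNReal NNReal

section Couplings

variable {X Y : Type*} [MeasurableSpace X] [MeasurableSpace Y]

lemma Continuous.integrable_of_compactSpace {Z : Type*} [TopologicalSpace Z] [CompactSpace Z]
    [MeasurableSpace Z] [BorelSpace Z] {f : Z → ℝ} (hf : Continuous f) (μ : Measure Z)
    [IsFiniteMeasure μ] : Integrable f μ :=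
  integrableOn_univ.1 (hf.continuousOn.integrableOn_compact' isCompact_univ MeasurableSet.univ)

lemma Continuous.exists_norm_le_of_compactSpace {Z : Type*} [TopologicalSpace Z] [CompactSpace Z]
    {f : Z → ℝ} (hf : Continuous f) : ∃ C, ∀ z, ‖f z‖ ≤ C := by
  obtain ⟨C, hC⟩ := isCompact_univ.exists_bound_of_continuousOn hf.continuousOn
  exact ⟨C, fun z => hC z (Set.mem_univ z)⟩

lemma isProbabilityMeasure_of_map_eq {f : X → Y} (hf : Measurable f) {μ : Measure X}
    {ν : Measure Y} [IsProbabilityMeasure ν] (h : μ.map f = ν) : IsProbabilityMeasure μ := by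
  constructor
  rw [← measure_univ (μ := ν), ← h, Measure.map_apply hf MeasurableSet.univ, Set.preimage_univ]

lemma integral_measure_comp {E : Type*} [NormedAddCommGroup E] [NormedSpace ℝ E]
    {μ : Measure X} {κ : Kernel X Y} {f : Y → E} (hf : Integrable f (κ ∘ₘ μ)) :
    ∫ y, f y ∂(κ ∘ₘ μ) = ∫ x, ∫ y, f y ∂(κ x) ∂μ := by
  rw [Measure.comp_eq_comp_const_apply] at hf ⊢
  rw [Kernel.integral_comp hf, Kernel.const_apply]

lemma map_fst_parallelComp_comp {X' Y' : Type*} [MeasurableSpace X'] [MeasurableSpace Y']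
    (κ : Kernel X X') (η : Kernel Y Y') [IsMarkovKernel κ] [IsMarkovKernel η]
    (π : Measure (X × Y)) :
    ((κ ∥ₖ η) ∘ₘ π).map Prod.fst = κ ∘ₘ (π.map Prod.fst) := by
  ext s hs
  rw [Measure.map_apply measurable_fst hs, Measure.bind_apply (measurable_fst hs)
    (Kernel.aemeasurable _), Measure.bind_apply hs (Kernel.aemeasurable _),
    lintegral_map (κ.measurable_coe hs) measurable_fst]
  congr with p
  rw [Kernel.parallelComp_apply, ← Set.prod_univ, Measure.prod_prod, measure_univ, mul_one]

lemma map_snd_parallelComp_comp {X' Y' : Type*} [MeasurableSpace X'] [MeasurableSpace Y']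
    (κ : Kernel X X') (η : Kernel Y Y') [IsMarkovKernel κ] [IsMarkovKernel η]
    (π : Measure (X × Y)) :
    ((κ ∥ₖ η) ∘ₘ π).map Prod.snd = η ∘ₘ (π.map Prod.snd) := by
  ext s hs
  rw [Measure.map_apply measurable_snd hs, Measure.bind_apply (measurable_snd hs)
    (Kernel.aemeasurable _), Measure.bind_apply hs (Kernel.aemeasurable _),
    lintegral_map (η.measurable_coe hs) measurable_snd]
  congr with p
  rw [Kernel.parallelComp_apply, ← Set.univ_prod, Measure.prod_prod, measure_univ, one_mul]

/-- A coupling of `μ` and `T♯μ` lifts along `T` to a coupling of `μ` with itself. -/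
lemma exists_selfCoupling_map_eq [StandardBorelSpace X] [Nonempty X] [MeasurableEq Y]
    {T : X → Y} (hT : Measurable T) (μ : Measure X) [IsProbabilityMeasure μ]
    {π : Measure (X × Y)} (h₁ : π.map Prod.fst = μ) (h₂ : π.map Prod.snd = μ.map T) :
    ∃ θ : Measure (X × X), θ.map Prod.fst = μ ∧ θ.map Prod.snd = μ ∧
      θ.map (fun p => (p.1, T p.2)) = π := by
  set κ := condDistrib (id : X → X) T μ
  have hκ : ∀ᵐ y ∂(μ.map T), ∀ᵐ x ∂(κ y), T x = y := by
    have h : ∀ᵐ q ∂((μ.map T) ⊗ₘ κ), T q.2 = q.1 := by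
      rw [compProd_map_condDistrib aemeasurable_id]
      refine (ae_map_iff (by fun_prop) ?_).2 (ae_of_all _ fun x => rfl)
      exact measurableSet_eq_fun (hT.comp measurable_snd) measurable_fst
    exact Measure.ae_ae_of_ae_compProd h
  refine ⟨(Kernel.id ∥ₖ κ) ∘ₘ π, ?_, ?_, ?_⟩
  · rw [map_fst_parallelComp_comp, h₁, Measure.id_comp]
  · rw [map_snd_parallelComp_comp, h₂, condDistrib_comp_map hT.aemeasurable aemeasurable_id,
      Measure.map_id]
  · have hm : Measurable fun p : X × X => (p.1, T p.2) := by fun_prop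
    rw [Measure.map_comp _ _ hm]
    have hπ : ∀ᵐ p ∂π, ∀ᵐ x ∂(κ p.2), T x = p.2 := by
      rw [← h₂] at hκ
      exact ae_of_ae_map measurable_snd.aemeasurable hκ
    have : ∀ᵐ p ∂π, (((Kernel.id : Kernel X X) ∥ₖ κ).map fun q : X × X => (q.1, T q.2)) p
        = (Kernel.id : Kernel (X × Y) (X × Y)) p := by
      filter_upwards [hπ] with p hp
      rw [Kernel.map_apply _ hm, Kernel.parallelComp_apply, Kernel.id_apply, Kernel.id_apply]
      change ((Measure.dirac p.1).prod (κ p.2)).map (Prod.map id T) = _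
      rw [← Measure.map_prod_map _ _ measurable_id hT, Measure.map_id, Measure.map_congr hp,
        Measure.map_const, measure_univ, one_smul, Measure.dirac_prod_dirac]
    rw [Measure.comp_congr this, Measure.id_comp]

end Couplings

section Kantorovich

variable {X Y : Type*} [TopologicalSpace X] [TopologicalSpace Y] [CompactSpace X] [CompactSpace Y]
  [MeasurableSpace X] [MeasurableSpace Y] {c : X → Y → ℝ}

lemma kantorovichCost_le_integral (hc : Continuous (Function.uncurry c)) {μ : Measure X}
    {ν : Measure Y} [IsProbabilityMeasure μ] {π : Measure (X × Y)}
    (h₁ : π.map Prod.fst = μ) (h₂ : π.map Prod.snd = ν) :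
    kantorovichCost c μ ν ≤ ∫ p, c p.1 p.2 ∂π := by
  obtain ⟨C, hC⟩ := hc.exists_norm_le_of_compactSpace
  refine csInf_le ⟨-C, ?_⟩ ⟨π, isProbabilityMeasure_of_map_eq measurable_fst h₁, h₁, h₂, rfl⟩
  rintro r ⟨π', hπ', -, -, rfl⟩
  have h := norm_integral_le_of_norm_le_const (μ := π') (ae_of_all _ hC)
  rw [probReal_univ, mul_one] at h
  exact (abs_le.1 h).1

end Kantorovich

/-- If `T` is optimal from `ρ`, it is optimal from every `μ` with bounded density
with respect to `ρ`. -/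
lemma integral_le_of_le_smul {X : Type*} [MetricSpace X] [CompactSpace X]
    [MeasurableSpace X] [BorelSpace X] {c : X → X → ℝ} (hc : Continuous (Function.uncurry c))
    {T : X → X} (hT : Continuous T) {ρ μ : Measure X} [IsProbabilityMeasure ρ]
    [IsProbabilityMeasure μ] (hgap : mongeGap c ρ T = 0) {C : ℝ≥0} (hC : μ ≤ C • ρ)
    {π : Measure (X × X)} (h₁ : π.map Prod.fst = μ) (h₂ : π.map Prod.snd = μ.map T) :
    ∫ x, c x (T x) ∂μ ≤ ∫ p, c p.1 p.2 ∂π := by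
  have hC0 : C ≠ 0 := by
    rintro rfl
    have := hC Set.univ
    simp at this
  have hC' : C⁻¹ • μ ≤ ρ := by
    intro s
    have h := hC s
    simp only [Measure.smul_apply, ENNReal.smul_def, smul_eq_mul] at h ⊢
    rw [ENNReal.coe_inv hC0, mul_comm, ← div_eq_mul_inv]
    exact ENNReal.div_le_of_le_mul' h
  have hprob : IsProbabilityMeasure π := isProbabilityMeasure_of_map_eq measurable_fst h₁
  set σ := ρ - C⁻¹ • μ
  have hσ : σ + C⁻¹ • μ = ρ := Measure.sub_add_cancel_of_le hC'
  have : IsFiniteMeasure σ := isFiniteMeasure_of_le ρ Measure.sub_le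
  have hF : Continuous fun x => c x (T x) := hc.comp (continuous_id.prodMk hT)
  have hg : Measurable fun x => (x, T x) := (continuous_id.prodMk hT).measurable
  have key := kantorovichCost_le_integral hc (μ := ρ) (ν := ρ.map T)
    (π := σ.map (fun x => (x, T x)) + C⁻¹ • π) ?_ ?_
  · rw [mongeGap, sub_eq_zero] at hgap
    have hc' : Continuous fun p : X × X => c p.1 p.2 := hc
    rw [← hgap, integral_add_measure (hc'.integrable_of_compactSpace _)
      (hc'.integrable_of_compactSpace _), integral_map hg.aemeasurable
      hc'.aestronglyMeasurable, ← hσ, integral_add_measure (hF.integrable_of_compactSpace _)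
      (hF.integrable_of_compactSpace _), integral_smul_nnreal_measure,
      integral_smul_nnreal_measure] at key
    have hpos : (0 : ℝ) < C⁻¹ := by positivity
    have h := le_of_add_le_add_left key
    simp only [NNReal.smul_def, smul_eq_mul] at h
    exact le_of_mul_le_mul_left h (by exact_mod_cast hpos)
  · rw [Measure.map_add _ _ measurable_fst, Measure.map_map measurable_fst hg, Measure.map_smul, h₁]
    exact (congrArg (· + _) Measure.map_id).trans hσ
  · rw [Measure.map_add _ _ measurable_snd, Measure.map_map measurable_snd hg, Measure.map_smul, h₂,
      ← Measure.map_smul, ← hσ, Measure.map_add _ _ hT.measurable]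
    rfl

/-- Probability measures concentrating at `a` integrate functions continuous at `a` to
their value at `a` in the limit. -/
lemma tendsto_integral_of_eventually_ae_mem {Z : Type*} [TopologicalSpace Z] [MeasurableSpace Z]
    {P : ℕ → Measure Z} [∀ n, IsProbabilityMeasure (P n)] {a : Z} {f : Z → ℝ}
    (hf : ContinuousAt f a) (hi : ∀ n, Integrable f (P n))
    (h : ∀ U ∈ 𝓝 a, ∀ᶠ n in atTop, ∀ᵐ z ∂(P n), z ∈ U) :
    Tendsto (fun n => ∫ z, f z ∂(P n)) atTop (𝓝 (f a)) := by
  rw [Metric.nhds_basis_closedBall.tendsto_right_iff]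
  intro ε hε
  filter_upwards [h _ (hf (Metric.closedBall_mem_nhds (f a) hε))] with n hn
  exact (convex_closedBall _ _).integral_mem Metric.isClosed_closedBall hn (hi n)

section Averaging

variable {X : Type*} [MetricSpace X] [MeasurableSpace X]

/-- The kernel averaging `ρ` over the ball of radius `r` around `e x`. -/
noncomputable def ballKernel (ρ : Measure X) (e : SimpleFunc X X) (r : ℝ) : Kernel X X where
  toFun x := ρ[|Metric.ball (e x) r]
  measurable' := (e.map fun y => ρ[|Metric.ball y r]).measurable

lemma ballKernel_apply (ρ : Measure X) (e : SimpleFunc X X) (r : ℝ) (x : X) :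
    ballKernel ρ e r x = ρ[|Metric.ball (e x) r] := rfl

lemma isMarkovKernel_ballKernel {ρ : Measure X} [IsFiniteMeasure ρ] {e : SimpleFunc X X} {r : ℝ}
    (h : ∀ x, ρ (Metric.ball (e x) r) ≠ 0) : IsMarkovKernel (ballKernel ρ e r) :=
  ⟨fun x => cond_isProbabilityMeasure (h x)⟩

variable [BorelSpace X]

lemma exists_ballKernel_comp_le_smul {ρ : Measure X} {e : SimpleFunc X X} {r : ℝ}
    (h : ∀ x, ρ (Metric.ball (e x) r) ≠ 0) (μ : Measure X) [IsProbabilityMeasure μ] :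
    ∃ C : ℝ≥0, ballKernel ρ e r ∘ₘ μ ≤ C • ρ := by
  refine ⟨∑ y ∈ e.range, ((ρ (Metric.ball y r))⁻¹).toNNReal, Measure.le_iff.2 fun s hs => ?_⟩
  rw [Measure.bind_apply hs (Kernel.aemeasurable _)]
  refine (lintegral_mono (g := fun _ => _) fun x => ?_).trans_eq
    ((lintegral_const _).trans (by rw [measure_univ, mul_one]))
  rw [ballKernel_apply, cond_apply Metric.isOpen_ball.measurableSet, Measure.smul_apply,
    ENNReal.smul_def, smul_eq_mul]
  refine mul_le_mul' ?_ (measure_mono Set.inter_subset_right)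
  rw [← ENNReal.coe_toNNReal (ENNReal.inv_ne_top.2 (h x))]
  exact ENNReal.coe_le_coe.2 (Finset.single_le_sum
    (f := fun y => ((ρ (Metric.ball y r))⁻¹).toNNReal) (fun _ _ => zero_le)
    (e.mem_range_self x))

lemma eventually_ae_ballKernel_mem {ρ : Measure X} {e : ℕ → SimpleFunc X X} {r : ℕ → ℝ} {x : X}
    (he : Tendsto (fun n => e n x) atTop (𝓝 x)) (hr : Tendsto r atTop (𝓝 0))
    {U : Set X} (hU : U ∈ 𝓝 x) :
    ∀ᶠ n in atTop, ∀ᵐ y ∂(ballKernel ρ (e n) (r n) x), y ∈ U := by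
  obtain ⟨ε, hε, hεU⟩ := Metric.mem_nhds_iff.1 hU
  filter_upwards [he (Metric.ball_mem_nhds x (half_pos hε)),
    hr.eventually_lt_const (half_pos hε)] with n hn hrn
  filter_upwards [ae_cond_mem (μ := ρ) (Metric.isOpen_ball (x := e n x) (ε := r n)).measurableSet]
    with y hy
  apply hεU
  have h₁ : dist (e n x) x < ε / 2 := hn
  have h₂ : dist y (e n x) < r n := hy
  have := dist_triangle y (e n x) x
  rw [Metric.mem_ball]
  linarith

end Averaging

/-- If `T` is optimal from `ρ` and `μ` is supported in the support of `ρ`, then rematching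
the points of `μ` with their images according to a coupling of `μ` with itself does not
decrease the cost. -/
lemma integral_le_integral_selfCoupling {X : Type*} [MetricSpace X] [CompactSpace X]
    [MeasurableSpace X] [BorelSpace X] {c : X → X → ℝ} (hc : Continuous (Function.uncurry c))
    {T : X → X} (hT : Continuous T) {ρ μ : Measure X} [IsProbabilityMeasure ρ]
    [IsProbabilityMeasure μ] (hgap : mongeGap c ρ T = 0) (hspt : μ.support ⊆ ρ.support)
    {θ : Measure (X × X)} (h₁ : θ.map Prod.fst = μ) (h₂ : θ.map Prod.snd = μ) :
    ∫ x, c x (T x) ∂μ ≤ ∫ p, c p.1 (T p.2) ∂θ := by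
  have hθ : IsProbabilityMeasure θ := isProbabilityMeasure_of_map_eq measurable_fst h₁
  obtain ⟨x₀, hx₀⟩ := Measure.nonempty_support (IsProbabilityMeasure.ne_zero μ)
  set e : ℕ → SimpleFunc X X :=
    SimpleFunc.approxOn id measurable_id μ.support x₀ hx₀
  set r : ℕ → ℝ := fun n => 1 / ((n : ℝ) + 1)
  have hr : Tendsto r atTop (𝓝 0) := tendsto_one_div_add_atTop_nhds_zero_nat
  have he : ∀ x ∈ μ.support, Tendsto (fun n => e n x) atTop (𝓝 x) := fun x hx =>
    SimpleFunc.tendsto_approxOn measurable_id hx₀ (subset_closure hx)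
  have hpos : ∀ n x, ρ (Metric.ball (e n x) (r n)) ≠ 0 := fun n x =>
    ((Measure.mem_support_iff_forall _).1 (hspt (SimpleFunc.approxOn_mem measurable_id hx₀ n x)) _
      (Metric.ball_mem_nhds _ Nat.one_div_pos_of_nat)).ne'
  set κ : ℕ → Kernel X X := fun n => ballKernel ρ (e n) (r n)
  have hκ : ∀ n, IsMarkovKernel (κ n) := fun n => isMarkovKernel_ballKernel (hpos n)
  have hF : Continuous fun x => c x (T x) := hc.comp (continuous_id.prodMk hT)
  have hG : Continuous fun p : X × X => c p.1 (T p.2) :=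
    hc.comp (continuous_fst.prodMk (hT.comp continuous_snd))
  have hsupp : ∀ᵐ x ∂μ, x ∈ μ.support := Measure.support_mem_ae
  have hκU : ∀ x ∈ μ.support, ∀ U ∈ 𝓝 x, ∀ᶠ n in atTop, ∀ᵐ y ∂(κ n x), y ∈ U :=
    fun x hx U hU => eventually_ae_ballKernel_mem (he x hx) hr hU
  have ineq : ∀ n, ∫ x, ∫ y, c y (T y) ∂(κ n x) ∂μ ≤
      ∫ p, ∫ q, c q.1 (T q.2) ∂((κ n ∥ₖ κ n) p) ∂θ := by
    intro n
    obtain ⟨C, hC⟩ := exists_ballKernel_comp_le_smul (hpos n) μ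
    have hm : Measurable fun p : X × X => (p.1, T p.2) :=
      (continuous_fst.prodMk (hT.comp continuous_snd)).measurable
    have h := integral_le_of_le_smul hc hT hgap (μ := κ n ∘ₘ μ) hC
      (π := ((κ n ∥ₖ κ n) ∘ₘ θ).map fun p => (p.1, T p.2)) ?_ ?_
    · have hc' : Continuous fun p : X × X => c p.1 p.2 := hc
      rwa [integral_map hm.aemeasurable hc'.aestronglyMeasurable,
        integral_measure_comp (hF.integrable_of_compactSpace _),
        integral_measure_comp (hG.integrable_of_compactSpace _)] at h
    · rw [Measure.map_map measurable_fst hm, ← h₁, ← map_fst_parallelComp_comp (κ n) (κ n)]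
      rfl
    · rw [Measure.map_map measurable_snd hm, ← h₂, ← map_snd_parallelComp_comp (κ n) (κ n),
        Measure.map_map hT.measurable measurable_snd]
      rfl
  have bound : ∀ {Z : Type _} [MeasurableSpace Z] {f : Z → ℝ} {C : ℝ} (P : Measure Z)
      [IsProbabilityMeasure P], (∀ z, ‖f z‖ ≤ C) → ‖∫ z, f z ∂P‖ ≤ C := by
    intro Z _ f C P _ hf
    simpa using norm_integral_le_of_norm_le_const (μ := P) (ae_of_all _ hf)
  obtain ⟨CF, hCF⟩ := hF.exists_norm_le_of_compactSpace
  obtain ⟨CG, hCG⟩ := hG.exists_norm_le_of_compactSpace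
  have limF : Tendsto (fun n => ∫ x, ∫ y, c y (T y) ∂(κ n x) ∂μ) atTop
      (𝓝 (∫ x, c x (T x) ∂μ)) := by
    refine tendsto_integral_of_dominated_convergence (fun _ => CF)
      (fun n => (hF.measurable.stronglyMeasurable.integral_kernel).aestronglyMeasurable)
      (integrable_const _) (fun n => ae_of_all _ fun x => bound _ hCF) ?_
    filter_upwards [hsupp] with x hx
    exact tendsto_integral_of_eventually_ae_mem (P := fun n => κ n x) hF.continuousAt
      (fun n => hF.integrable_of_compactSpace _) (hκU x hx)
  have limG : Tendsto (fun n => ∫ p, ∫ q, c q.1 (T q.2) ∂((κ n ∥ₖ κ n) p) ∂θ) atTop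
      (𝓝 (∫ p, c p.1 (T p.2) ∂θ)) := by
    refine tendsto_integral_of_dominated_convergence (fun _ => CG)
      (fun n => (hG.measurable.stronglyMeasurable.integral_kernel).aestronglyMeasurable)
      (integrable_const _) (fun n => ae_of_all _ fun x => bound _ hCG) ?_
    filter_upwards [ae_of_ae_map measurable_fst.aemeasurable (h₁.symm ▸ hsupp :
        ∀ᵐ x ∂(θ.map Prod.fst), x ∈ μ.support),
      ae_of_ae_map measurable_snd.aemeasurable (h₂.symm ▸ hsupp :
        ∀ᵐ x ∂(θ.map Prod.snd), x ∈ μ.support)] with p hp₁ hp₂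
    refine tendsto_integral_of_eventually_ae_mem (P := fun n => (κ n ∥ₖ κ n) p) hG.continuousAt
      (fun n => hG.integrable_of_compactSpace _) fun U hU => ?_
    obtain ⟨V, hV, W, hW, hVW⟩ := mem_nhds_prod_iff.1 hU
    filter_upwards [hκU p.1 hp₁ V hV, hκU p.2 hp₂ W hW] with n hnV hnW
    rw [Kernel.parallelComp_apply]
    filter_upwards [Measure.quasiMeasurePreserving_fst.ae hnV,
      Measure.quasiMeasurePreserving_snd.ae hnW] with q hq₁ hq₂
    exact hVW ⟨hq₁, hq₂⟩
  exact le_of_tendsto_of_tendsto' limF limG ineq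

lemma measureSupport_eq_support {X : Type*} [TopologicalSpace X] [MeasurableSpace X]
    (μ : Measure X) : measureSupport μ = μ.support := by
  ext x
  rw [(nhds_basis_opens x).mem_measureSupport]
  exact ⟨fun h U hU => h U hU.1 hU.2, fun h U hx hU => h U ⟨hx, hU⟩⟩

/-- Proposition: "who can do more can do less": if `Spt(μ) ⊆ Spt(ρ)`,
`T♯μ = ν` and `M^c_ρ(T) = 0`, then `T` is a `c`-optimal transport map between `μ`
and `ν`. -/
theorem monge_gap_zero_optimal_on_smaller_support {d : ℕ}
    (Ω : Set (EuclideanSpace ℝ (Fin d))) (hΩ : IsCompact Ω)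
    (c : Ω → Ω → ℝ) (hc : Continuous (Function.uncurry c))
    (ρ μ ν : Measure Ω) (hρ : IsProbabilityMeasure ρ) (hμ : IsProbabilityMeasure μ)
    (hν : IsProbabilityMeasure ν)
    (hspt : measureSupport μ ⊆ measureSupport ρ)
    (T : Ω → Ω) (hT : Continuous T)
    (hpush : μ.map T = ν) (hgap : mongeGap c ρ T = 0) :
    (∫ x, c x (T x) ∂μ) = kantorovichCost c μ ν := by
  have : CompactSpace Ω := isCompact_iff_compactSpace.1 hΩ
  have : Nonempty Ω := nonempty_of_isProbabilityMeasure μ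
  have hF : Continuous fun x => (x, T x) := continuous_id.prodMk hT
  have h₁ : (μ.map fun x => (x, T x)).map Prod.fst = μ := by
    rw [Measure.map_map measurable_fst hF.measurable]
    exact Measure.map_id
  have h₂ : (μ.map fun x => (x, T x)).map Prod.snd = ν := by
    rw [Measure.map_map measurable_snd hF.measurable, ← hpush]
    rfl
  have hcost : ∫ p, c p.1 p.2 ∂(μ.map fun x => (x, T x)) = ∫ x, c x (T x) ∂μ :=
    integral_map hF.measurable.aemeasurable hc.aestronglyMeasurable
  apply le_antisymm
  · refine le_csInf ⟨_, _, isProbabilityMeasure_of_map_eq measurable_fst h₁, h₁, h₂, rfl⟩ ?_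
    rintro r ⟨π, -, hπ₁, hπ₂, rfl⟩
    obtain ⟨θ, hθ₁, hθ₂, rfl⟩ :=
      exists_selfCoupling_map_eq hT.measurable μ hπ₁ (hπ₂.trans hpush.symm)
    rw [measureSupport_eq_support, measureSupport_eq_support] at hspt
    have hm : Measurable fun p : Ω × Ω => (p.1, T p.2) :=
      (continuous_fst.prodMk (hT.comp continuous_snd)).measurable
    have hc' : Continuous fun p : Ω × Ω => c p.1 p.2 := hc
    rw [integral_map hm.aemeasurable hc'.aestronglyMeasurable]
    exact integral_le_integral_selfCoupling hc hT hgap hspt hθ₁ hθ₂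
  · rw [← hcost]
    exact kantorovichCost_le_integral hc h₁ h₂
end

section
/- (Convexity of the empirical entropic Monge gap for the squared-Euclidean cost.) Fix n ≥ 1, d ≥ 1, ε ≥ 0, and points x_1, …, x_n ∈ ℝ^d stored as the rows of X ∈ ℝ^{n×d}. Define, for T ∈ ℝ^{n×d} with rows t_1, …, t_n, r(T) := (1/n)‖X − T‖_F² − min_{P ∈ U_n} ( Σ_{i,j} P_{ij} ‖x_i − t_j‖₂² − ε H(P) ), where U_n := {P ∈ ℝ^{n×n} : P_{ij} ≥ 0, Σ_j P_{ij} = 1/n for all i, Σ_i P_{ij} = 1/n for all j} and H(P) := −Σ_{i,j} P_{ij} log P_{ij} (with 0·log 0 := 0). Then r is a convex function on ℝ^{n×d}. -/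
open Finset

/-- The scaled Birkhoff polytope: `n × n` matrices with nonnegative entries whose
every row sum and every column sum equals `1/n`. -/
def scaledBirkhoff (n : ℕ) : Set (Matrix (Fin n) (Fin n) ℝ) :=
  {P | (∀ i j, 0 ≤ P i j) ∧ (∀ i, ∑ j, P i j = 1 / n) ∧ (∀ j, ∑ i, P i j = 1 / n)}

/-- The entropy `H(P) = −Σ_{i,j} P_{ij} log P_{ij}` (with `0 · log 0 = 0`,
which holds automatically since `Real.log 0 = 0`). -/
noncomputable def matrixEntropy {n : ℕ} (P : Matrix (Fin n) (Fin n) ℝ) : ℝ :=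
  -∑ i, ∑ j, P i j * Real.log (P i j)

/-- The quadratic identity `|x - (a s + b t)|² = a |x - s|² + b |x - t|² - a b |s - t|²`
for `a + b = 1`. -/
lemma sum_sq_sub_convexCombo {d : ℕ} (x s t : Fin d → ℝ) {a b : ℝ} (hab : a + b = 1) :
    ∑ k, (x k - (a * s k + b * t k)) ^ 2 =
      a * ∑ k, (x k - s k) ^ 2 + b * ∑ k, (x k - t k) ^ 2 - a * b * ∑ k, (s k - t k) ^ 2 := by
  obtain rfl : b = 1 - a := by linarith
  simp only [mul_sum, ← sum_add_distrib, ← sum_sub_distrib]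
  exact sum_congr rfl fun k _ => by ring

/-- The transport cost minus the squared distance to the identity coupling is affine. -/
lemma transportCost_convexCombo {n d : ℕ} {P : Matrix (Fin n) (Fin n) ℝ}
    (hP : P ∈ scaledBirkhoff n) (X S T : Matrix (Fin n) (Fin d) ℝ) {a b : ℝ} (hab : a + b = 1) :
    (∑ i, ∑ j, P i j * ∑ k, (X i k - (a * S j k + b * T j k)) ^ 2) =
      (1 / n) * (∑ i, ∑ k, (X i k - (a * S i k + b * T i k)) ^ 2)
      + a * ((∑ i, ∑ j, P i j * ∑ k, (X i k - S j k) ^ 2)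
          - (1 / n) * ∑ i, ∑ k, (X i k - S i k) ^ 2)
      + b * ((∑ i, ∑ j, P i j * ∑ k, (X i k - T j k) ^ 2)
          - (1 / n) * ∑ i, ∑ k, (X i k - T i k) ^ 2) := by
  have hmarg : ∑ i, ∑ j, P i j * ∑ k, (S j k - T j k) ^ 2 =
      (1 / n) * ∑ j, ∑ k, (S j k - T j k) ^ 2 := by
    rw [sum_comm, mul_sum]
    exact sum_congr rfl fun j _ => by rw [← sum_mul, hP.2.2 j]
  have hcost : (∑ i, ∑ j, P i j * ∑ k, (X i k - (a * S j k + b * T j k)) ^ 2) =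
      a * (∑ i, ∑ j, P i j * ∑ k, (X i k - S j k) ^ 2)
      + b * (∑ i, ∑ j, P i j * ∑ k, (X i k - T j k) ^ 2)
      - a * b * (∑ i, ∑ j, P i j * ∑ k, (S j k - T j k) ^ 2) := by
    rw [mul_sum, mul_sum, mul_sum, ← sum_add_distrib, ← sum_sub_distrib]
    refine sum_congr rfl fun i _ => ?_
    rw [mul_sum, mul_sum, mul_sum, ← sum_add_distrib, ← sum_sub_distrib]
    refine sum_congr rfl fun j _ => ?_
    rw [sum_sq_sub_convexCombo (X i) (S j) (T j) hab]
    ring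
  have hdiag : (∑ i, ∑ k, (X i k - (a * S i k + b * T i k)) ^ 2) =
      a * (∑ i, ∑ k, (X i k - S i k) ^ 2) + b * (∑ i, ∑ k, (X i k - T i k) ^ 2)
      - a * b * (∑ i, ∑ k, (S i k - T i k) ^ 2) := by
    rw [mul_sum, mul_sum, mul_sum, ← sum_add_distrib, ← sum_sub_distrib]
    exact sum_congr rfl fun i _ => sum_sq_sub_convexCombo (X i) (S i) (T i) hab
  rw [hcost, hdiag, hmarg]
  ring

lemma neg_one_le_mul_log {x : ℝ} (hx : 0 ≤ x) : -1 ≤ x * Real.log x := by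
  rcases hx.eq_or_lt with rfl | hx
  · simp
  · have h := mul_le_mul_of_nonneg_left (Real.one_sub_inv_le_log_of_pos hx) hx.le
    rw [mul_sub, mul_inv_cancel₀ hx.ne'] at h
    linarith

lemma matrixEntropy_le {n : ℕ} {P : Matrix (Fin n) (Fin n) ℝ} (hP : ∀ i j, 0 ≤ P i j) :
    matrixEntropy P ≤ n * n := by
  have h : ∑ _i : Fin n, ∑ _j : Fin n, (-1 : ℝ) ≤ ∑ i, ∑ j, P i j * Real.log (P i j) :=
    sum_le_sum fun i _ => sum_le_sum fun j _ => neg_one_le_mul_log (hP i j)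
  simp only [sum_const, card_univ, Fintype.card_fin, nsmul_eq_mul] at h
  unfold matrixEntropy
  linarith

lemma scaledBirkhoff_nonempty {n : ℕ} (hn : 1 ≤ n) : (scaledBirkhoff n).Nonempty := by
  have hn' : (n : ℝ) ≠ 0 := by positivity
  refine ⟨fun _ _ => 1 / n * (1 / n), fun _ _ => by positivity, fun _ => ?_, fun _ => ?_⟩ <;>
  · simp only [sum_const, card_univ, Fintype.card_fin, nsmul_eq_mul]
    field_simp

lemma bddBelow_entropicCost {n d : ℕ} {ε : ℝ} (hε : 0 ≤ ε) (X T : Matrix (Fin n) (Fin d) ℝ) :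
    BddBelow {v : ℝ | ∃ P ∈ scaledBirkhoff n,
      v = (∑ i, ∑ j, P i j * (∑ k, (X i k - T j k) ^ 2)) - ε * matrixEntropy P} := by
  refine ⟨-(ε * (n * n)), ?_⟩
  rintro _ ⟨P, hP, rfl⟩
  have h₁ : 0 ≤ ∑ i, ∑ j, P i j * (∑ k, (X i k - T j k) ^ 2) :=
    sum_nonneg fun i _ => sum_nonneg fun j _ =>
      mul_nonneg (hP.1 i j) (sum_nonneg fun k _ => sq_nonneg _)
  have h₂ := mul_le_mul_of_nonneg_left (matrixEntropy_le hP.1) hε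
  linarith

/-- convexity of the empirical entropic Monge gap for the
squared-Euclidean cost: the function
`r(T) = (1/n)‖X − T‖_F² − min_{P ∈ U_n} (Σ_{ij} P_{ij}‖x_i − t_j‖² − ε H(P))`
is convex on `ℝ^{n×d}`. -/
theorem empirical_entropic_monge_gap_convex (n d : ℕ) (hn : 1 ≤ n) (hd : 1 ≤ d)
    (ε : ℝ) (hε : 0 ≤ ε) (X : Matrix (Fin n) (Fin d) ℝ) :
    ConvexOn ℝ Set.univ (fun T : Matrix (Fin n) (Fin d) ℝ =>
      (1 / n) * (∑ i, ∑ k, (X i k - T i k) ^ 2) -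
        sInf {v : ℝ | ∃ P ∈ scaledBirkhoff n,
          v = (∑ i, ∑ j, P i j * (∑ k, (X i k - T j k) ^ 2)) - ε * matrixEntropy P}) := by
  refine ⟨convex_univ, fun S _ T _ a b ha hb hab => ?_⟩
  simp only [Matrix.add_apply, Matrix.smul_apply, smul_eq_mul]
  rw [sub_le_comm]
  obtain ⟨P₀, hP₀⟩ := scaledBirkhoff_nonempty hn
  refine le_csInf ⟨_, P₀, hP₀, rfl⟩ ?_
  rintro _ ⟨P, hP, rfl⟩
  have hS := mul_le_mul_of_nonneg_left
    (csInf_le (bddBelow_entropicCost hε X S) ⟨P, hP, rfl⟩) ha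
  have hT := mul_le_mul_of_nonneg_left
    (csInf_le (bddBelow_entropicCost hε X T) ⟨P, hP, rfl⟩) hb
  have hE : ε * matrixEntropy P = a * (ε * matrixEntropy P) + b * (ε * matrixEntropy P) := by
    rw [← add_mul, hab, one_mul]
  rw [transportCost_convexCombo hP X S T hab]
  linarith
end

section
/- (Convexity of the Monge gap for the squared-Euclidean cost.) Let Ω ⊂ ℝ^d be a compact set and ρ a Borel probability measure on Ω. Then the functional T ↦ M²_ρ(T) := ∫_Ω ‖x − T(x)‖₂² dρ(x) − W_{ℓ²₂}(ρ, T♯ρ) is convex on the real vector space of continuous maps T : Ω → ℝ^d; that is, for continuous T₀, T₁ : Ω → ℝ^d and λ ∈ [0,1], M²_ρ((1−λ)T₀ + λT₁) ≤ (1−λ) M²_ρ(T₀) + λ M²_ρ(T₁). -/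
open MeasureTheory

/-- The Kantorovich optimal transport cost for the squared-Euclidean cost:
infimum of `∫∫ ‖x − y‖² dπ` over couplings `π` of `μ` and `ν`. -/
noncomputable def quadraticCost {d : ℕ}
    (Ω : Set (EuclideanSpace ℝ (Fin d)))
    (μ : Measure Ω) (ν : Measure (EuclideanSpace ℝ (Fin d))) : ℝ :=
  sInf {r : ℝ | ∃ π : Measure (Ω × EuclideanSpace ℝ (Fin d)),
    IsProbabilityMeasure π ∧ π.map Prod.fst = μ ∧ π.map Prod.snd = ν ∧
    r = ∫ p, ‖(p.1 : EuclideanSpace ℝ (Fin d)) - p.2‖ ^ 2 ∂π}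

/-- The Monge gap for the squared-Euclidean cost. -/
noncomputable def mongeGap2 {d : ℕ} (Ω : Set (EuclideanSpace ℝ (Fin d)))
    (ρ : Measure Ω) (T : Ω → EuclideanSpace ℝ (Fin d)) : ℝ :=
  (∫ x, ‖(x : EuclideanSpace ℝ (Fin d)) - T x‖ ^ 2 ∂ρ) -
    quadraticCost Ω ρ (ρ.map T)

/-- Any coupling `π` of `μ` and `T♯ρ` is the image under `(x, x') ↦ (x, T x')` of a coupling of
`μ` and `ρ`. -/
theorem exists_coupling_lift {X Y E : Type*} [MeasurableSpace X] [StandardBorelSpace X]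
    [Nonempty X] [MeasurableSpace Y] [MeasurableSpace E] (ρ : Measure Y) [IsProbabilityMeasure ρ]
    {T : Y → E} (hT : Measurable T) (π : Measure (X × E)) [IsProbabilityMeasure π]
    (hπ : π.map Prod.snd = ρ.map T) :
    ∃ γ : Measure (X × Y), IsProbabilityMeasure γ ∧ γ.map Prod.snd = ρ ∧
      γ.map (fun p => (p.1, T p.2)) = π := by
  have : IsProbabilityMeasure (π.map Prod.swap) :=
    Measure.isProbabilityMeasure_map measurable_swap.aemeasurable
  set η := (π.map Prod.swap).condKernel with hη
  have hfst : (π.map Prod.swap).fst = ρ.map T := by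
    rw [Measure.fst, Measure.map_map measurable_fst measurable_swap, ← hπ]
    rfl
  have hdis : (ρ.map T).compProd η = π.map Prod.swap := by
    rw [← hfst]
    exact (π.map Prod.swap).disintegrate η
  have hmap : (ρ.compProd (η.comap T hT)).map (Prod.map T id) = (ρ.map T).compProd η := by
    have : IsProbabilityMeasure (ρ.map T) := Measure.isProbabilityMeasure_map hT.aemeasurable
    ext s hs
    rw [Measure.map_apply (hT.prodMap measurable_id) hs,
      Measure.compProd_apply (hT.prodMap measurable_id hs), Measure.compProd_apply hs,
      lintegral_map (ProbabilityTheory.Kernel.measurable_kernel_prodMk_left hs) hT]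
    rfl
  refine ⟨(ρ.compProd (η.comap T hT)).map Prod.swap,
    Measure.isProbabilityMeasure_map measurable_swap.aemeasurable, ?_, ?_⟩
  · rw [Measure.map_map measurable_snd measurable_swap]
    exact Measure.fst_compProd ρ (η.comap T hT)
  · have hm : Measurable fun p : X × Y => (p.1, T p.2) := by fun_prop
    have h := congrArg (Measure.map Prod.swap) (hmap.trans hdis)
    rw [Measure.map_map measurable_swap (hT.prodMap measurable_id),
      Measure.map_map measurable_swap measurable_swap, Prod.swap_swap_eq, Measure.map_id] at h
    rw [Measure.map_map hm measurable_swap]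
    exact h

/-- The cost of any coupling of `μ` and `ρ`, transported by `S`, bounds the optimal cost between
`μ` and `S♯ρ` from above. -/
theorem quadraticCost_map_le {d : ℕ} {Ω : Set (EuclideanSpace ℝ (Fin d))} (μ ρ : Measure Ω)
    {S : Ω → EuclideanSpace ℝ (Fin d)} (hS : Measurable S) (γ : Measure (Ω × Ω))
    [IsProbabilityMeasure γ] (h₁ : γ.map Prod.fst = μ) (h₂ : γ.map Prod.snd = ρ) :
    quadraticCost Ω μ (ρ.map S) ≤
      ∫ p, ‖(p.1 : EuclideanSpace ℝ (Fin d)) - S p.2‖ ^ 2 ∂γ := by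
  have hm : Measurable fun p : Ω × Ω => (p.1, S p.2) := by fun_prop
  refine csInf_le ⟨0, ?_⟩ ⟨γ.map fun p => (p.1, S p.2),
    Measure.isProbabilityMeasure_map hm.aemeasurable, ?_, ?_, ?_⟩
  · rintro r ⟨π, -, -, -, rfl⟩
    exact integral_nonneg fun p => by positivity
  · rw [Measure.map_map measurable_fst hm]
    exact h₁
  · rw [Measure.map_map measurable_snd hm, ← h₂, Measure.map_map hS measurable_snd]
    rfl
  · rw [integral_map hm.aemeasurable]
    exact Continuous.aestronglyMeasurable (by fun_prop)

theorem norm_sub_convexCombination_sq {E : Type*} [NormedAddCommGroup E] [InnerProductSpace ℝ E]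
    (x a b : E) (t : ℝ) :
    ‖x - ((1 - t) • a + t • b)‖ ^ 2 =
      (1 - t) * ‖x - a‖ ^ 2 + t * ‖x - b‖ ^ 2 - t * (1 - t) * ‖a - b‖ ^ 2 := by
  have h₁ : x - ((1 - t) • a + t • b) = (1 - t) • (x - a) + t • (x - b) := by module
  have h₂ : a - b = (x - b) - (x - a) := by abel
  rw [h₁, h₂, norm_add_sq_real, norm_sub_sq_real (x - b), norm_smul, norm_smul, mul_pow, mul_pow,
    Real.norm_eq_abs, Real.norm_eq_abs, sq_abs, sq_abs, real_inner_smul_left,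
    real_inner_smul_right, real_inner_comm]
  ring

/-- The integrated form of `norm_sub_convexCombination_sq` on a compact space. -/
theorem integral_norm_sub_convexCombination_sq {Z E : Type*} [TopologicalSpace Z] [CompactSpace Z]
    [T2Space Z] [MeasurableSpace Z] [OpensMeasurableSpace Z] [NormedAddCommGroup E]
    [InnerProductSpace ℝ E] (γ : Measure Z) [IsFiniteMeasure γ] {f a b : Z → E}
    (hf : Continuous f) (ha : Continuous a) (hb : Continuous b) (t : ℝ) :
    ∫ z, ‖f z - ((1 - t) • a z + t • b z)‖ ^ 2 ∂γ =
      (1 - t) * ∫ z, ‖f z - a z‖ ^ 2 ∂γ + t * ∫ z, ‖f z - b z‖ ^ 2 ∂γ -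
        t * (1 - t) * ∫ z, ‖a z - b z‖ ^ 2 ∂γ := by
  have hint : ∀ g : Z → ℝ, Continuous g → Integrable g γ := fun g hg =>
    integrableOn_univ.1 (hg.continuousOn.integrableOn_compact isCompact_univ)
  have h₁ := (hint (fun z => ‖f z - a z‖ ^ 2) (by fun_prop)).const_mul (1 - t)
  have h₂ := (hint (fun z => ‖f z - b z‖ ^ 2) (by fun_prop)).const_mul t
  have h₃ := (hint (fun z => ‖a z - b z‖ ^ 2) (by fun_prop)).const_mul (t * (1 - t))
  simp_rw [norm_sub_convexCombination_sq]
  rw [integral_sub (h₁.fun_add h₂) h₃, integral_add h₁ h₂, integral_const_mul, integral_const_mul,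
    integral_const_mul]

/-- convexity of the Monge gap for the squared-Euclidean cost:
the functional `T ↦ M²_ρ(T)` is convex on continuous vector fields. -/
theorem monge_gap_quadratic_convex {d : ℕ}
    (Ω : Set (EuclideanSpace ℝ (Fin d))) (hΩ : IsCompact Ω)
    (ρ : Measure Ω) [IsProbabilityMeasure ρ]
    (T₀ T₁ : Ω → EuclideanSpace ℝ (Fin d)) (hT₀ : Continuous T₀) (hT₁ : Continuous T₁)
    (lam : ℝ) (hlam : lam ∈ Set.Icc (0 : ℝ) 1) :
    mongeGap2 Ω ρ (fun x => (1 - lam) • T₀ x + lam • T₁ x) ≤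
      (1 - lam) * mongeGap2 Ω ρ T₀ + lam * mongeGap2 Ω ρ T₁ := by
  have : CompactSpace Ω := isCompact_iff_compactSpace.1 hΩ
  have : StandardBorelSpace Ω := hΩ.measurableSet.standardBorel
  have : Nonempty Ω := nonempty_of_isProbabilityMeasure ρ
  set T : Ω → EuclideanSpace ℝ (Fin d) := fun x => (1 - lam) • T₀ x + lam • T₁ x with hTdef
  have hT : Continuous T := by fun_prop
  have hρ := integral_norm_sub_convexCombination_sq ρ continuous_subtype_val hT₀ hT₁ lam
  suffices h : (∫ x, ‖(x : EuclideanSpace ℝ (Fin d)) - T x‖ ^ 2 ∂ρ)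
      - (1 - lam) * mongeGap2 Ω ρ T₀ - lam * mongeGap2 Ω ρ T₁ ≤ quadraticCost Ω ρ (ρ.map T) by
    rw [mongeGap2]
    linarith
  have hg : Measurable fun x : Ω => (x, T x) := by fun_prop
  refine le_csInf ⟨_, ρ.map fun x => (x, T x),
    Measure.isProbabilityMeasure_map hg.aemeasurable, ?_, ?_, rfl⟩ ?_
  · rw [Measure.map_map measurable_fst hg]
    exact Measure.map_id
  · rw [Measure.map_map measurable_snd hg]
    rfl
  rintro r ⟨π, hπ, hπ₁, hπ₂, rfl⟩
  obtain ⟨γ, hγ, hγ₂, rfl⟩ := exists_coupling_lift ρ hT.measurable π hπ₂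
  have hm : Measurable fun p : Ω × Ω => (p.1, T p.2) := by fun_prop
  have hγ₁ : γ.map Prod.fst = ρ := by
    rw [← hπ₁, Measure.map_map measurable_fst hm]
    rfl
  have hcost := integral_norm_sub_convexCombination_sq γ
    (continuous_subtype_val.comp continuous_fst) (hT₀.comp continuous_snd)
    (hT₁.comp continuous_snd) lam
  have hdiff : ∫ p : Ω × Ω, ‖T₀ p.2 - T₁ p.2‖ ^ 2 ∂γ = ∫ x, ‖T₀ x - T₁ x‖ ^ 2 ∂ρ := by
    rw [← hγ₂, integral_map measurable_snd.aemeasurable]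
    exact Continuous.aestronglyMeasurable (by fun_prop)
  have h₀ := mul_le_mul_of_nonneg_left
    (quadraticCost_map_le ρ ρ hT₀.measurable γ hγ₁ hγ₂) (sub_nonneg.2 hlam.2)
  have h₁ := mul_le_mul_of_nonneg_left
    (quadraticCost_map_le ρ ρ hT₁.measurable γ hγ₁ hγ₂) hlam.1
  rw [integral_map hm.aemeasurable (Continuous.aestronglyMeasurable (by fun_prop))]
  simp only [Function.comp_apply] at hcost
  simp only [hTdef, mongeGap2]
  rw [hρ, hcost, hdiff]
  linarith
end
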